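/- Suppose z ∈ ran( ∂f + Σ_{i=1}^m L_i*((K_i* ∘ ∂g_i ∘ K_i) □ (M_i* ∘ ∂l_i ∘ M_i))(L_i · − r_i) + ∇h ). Then the sequences generated by the forward-backward-forward Algorithm 4.6 satisfy Σ_{n≥0} ‖x_n − x̃_n‖² < +∞ and, for every i = 1,…,m, Σ_{n≥0} ‖p_{i,n} − p̃_{i,n}‖² < +∞ and Σ_{n≥0} ‖q_{i,n} − q̃_{i,n}‖² < +∞. -/

import Mathlib

open scoped RealInnerProductSpace ENNReal
open Filter Topology

noncomputable section

/-- `f ∈ Γ(E)`: proper, convex and lower semicontinuous -/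
def ProperConvLsc {E : Type*} [NormedAddCommGroup E] [InnerProductSpace ℝ E]
    (f : E → EReal) : Prop :=
  (∃ x, f x ≠ ⊤) ∧ (∀ x, f x ≠ ⊥) ∧
  (∀ x y : E, ∀ a b : ℝ, 0 ≤ a → 0 ≤ b → a + b = 1 →
    f (a • x + b • y) ≤ (a : EReal) * f x + (b : EReal) * f y) ∧
  LowerSemicontinuous f

/-- Fenchel conjugate -/
def econj {E : Type*} [NormedAddCommGroup E] [InnerProductSpace ℝ E]
    (f : E → EReal) (p : E) : EReal :=
  ⨆ x : E, ((⟪p, x⟫ : ℝ) : EReal) - f x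

/-- infimal convolution -/
def einfConv {E : Type*} [AddGroup E] (f g : E → EReal) (x : E) : EReal :=
  ⨅ y : E, f y + g (x - y)

/-- convex subdifferential -/
def esubdiff {E : Type*} [NormedAddCommGroup E] [InnerProductSpace ℝ E]
    (f : E → EReal) (x : E) : Set E :=
  {p | f x ≠ ⊤ ∧ f x ≠ ⊥ ∧ ∀ y, f x + ((⟪p, y - x⟫ : ℝ) : EReal) ≤ f y}

/-- effective domain -/
def edom {E : Type*} (f : E → EReal) : Set E := {x | f x ≠ ⊤}

def invOp {E : Type*} (A : E → Set E) : E → Set E := fun u => {x | u ∈ A x}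

def sumOp {E : Type*} [Add E] (A B : E → Set E) : E → Set E :=
  fun x => {s | ∃ u ∈ A x, ∃ v ∈ B x, s = u + v}

/-- parallel sum `A □ B = (A⁻¹ + B⁻¹)⁻¹` -/
def parOp {E : Type*} [Add E] (A B : E → Set E) : E → Set E :=
  invOp (sumOp (invOp A) (invOp B))

/-- `T* ∘ B ∘ T` -/
def compOp {F G : Type*} [NormedAddCommGroup F] [InnerProductSpace ℝ F] [CompleteSpace F]
    [NormedAddCommGroup G] [InnerProductSpace ℝ G] [CompleteSpace G]
    (T : F →L[ℝ] G) (B : G → Set G) : F → Set F :=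
  fun x => (ContinuousLinearMap.adjoint T) '' (B (T x))

/-- `x = Prox_{γ f}(w)`: `x` minimizes `u ↦ γ f(u) + ‖u - w‖²/2` -/
def IsProx {E : Type*} [NormedAddCommGroup E] [InnerProductSpace ℝ E]
    (γ : ℝ) (f : E → EReal) (w x : E) : Prop :=
  ∀ u : E, (γ : EReal) * f x + ((‖x - w‖ ^ 2 / 2 : ℝ) : EReal) ≤
    (γ : EReal) * f u + ((‖u - w‖ ^ 2 / 2 : ℝ) : EReal)

/-- weak convergence in a Hilbert space -/
def WConv {E : Type*} [NormedAddCommGroup E] [InnerProductSpace ℝ E] (u : ℕ → E) (l : E) : Prop :=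
  ∀ w : E, Tendsto (fun n => ⟪u n, w⟫) atTop (𝓝 ⟪l, w⟫)

/-- Real-valued form of the convexity inequality of an extended-real-valued function, restricted
to segments between points of its effective domain. -/
def RealSegmentConvex {E : Type*} [NormedAddCommGroup E] [InnerProductSpace ℝ E]
    (φ : E → EReal) : Prop :=
  ∀ (x u : E) (a b : ℝ), φ x = (a : EReal) → φ u = (b : EReal) →
    ∀ t : ℝ, 0 ≤ t → t ≤ 1 → φ ((1 - t) • x + t • u) ≤ (((1 - t) * a + t * b : ℝ) : EReal)

section ConvexAnalysis

variable {E : Type*} [NormedAddCommGroup E] [InnerProductSpace ℝ E]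

theorem ProperConvLsc.realSegmentConvex {φ : E → EReal} (hφ : ProperConvLsc φ) :
    RealSegmentConvex φ := by
  intro x u a b hx hu t ht0 ht1
  have := hφ.2.2.1 x u (1 - t) t (by linarith) ht0 (by ring)
  rw [hx, hu] at this
  exact_mod_cast this

theorem econj_le_coe_iff {φ : E → EReal} {p : E} {a : ℝ} :
    econj φ p ≤ (a : EReal) ↔ ∀ x, ((⟪p, x⟫ - a : ℝ) : EReal) ≤ φ x := by
  unfold econj
  rw [iSup_le_iff]
  refine forall_congr' fun x => ?_
  induction φ x with
  | bot => simp [-EReal.coe_sub]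
  | top => simp
  | coe c =>
    norm_cast
    constructor <;> intro h <;> linarith

theorem realSegmentConvex_econj (φ : E → EReal) : RealSegmentConvex (econj φ) := by
  intro p q a b hp hq t ht0 ht1
  have hp' := econj_le_coe_iff.1 hp.le
  have hq' := econj_le_coe_iff.1 hq.le
  refine econj_le_coe_iff.2 fun x => ?_
  have h1 := hp' x
  have h2 := hq' x
  revert h1 h2
  induction φ x with
  | bot => intro h1; simp [-EReal.coe_sub] at h1
  | top => simp
  | coe c =>
    intro h1 h2
    norm_cast at h1 h2 ⊢
    rw [inner_add_left, real_inner_smul_left, real_inner_smul_left]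
    nlinarith [mul_le_mul_of_nonneg_left h1 (sub_nonneg.2 ht1), mul_le_mul_of_nonneg_left h2 ht0]

theorem econj_ne_bot {φ : E → EReal} (hφ : ProperConvLsc φ) (p : E) : econj φ p ≠ ⊥ := by
  obtain ⟨x, hx⟩ := hφ.1
  have hb := hφ.2.1 x
  intro h
  have h1 : ((⟪p, x⟫ : ℝ) : EReal) - φ x ≤ econj φ p :=
    le_iSup (fun x => ((⟪p, x⟫ : ℝ) : EReal) - φ x) x
  rw [h, ← EReal.coe_toReal hx hb, ← EReal.coe_sub] at h1
  exact EReal.coe_ne_bot _ (le_bot_iff.1 h1)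

theorem mem_esubdiff_econj {φ : E → EReal} (hφ : ProperConvLsc φ) {x p : E}
    (hp : p ∈ esubdiff φ x) : x ∈ esubdiff (econj φ) p := by
  obtain ⟨htop, hbot, hsub⟩ := hp
  obtain ⟨c, hc⟩ : ∃ c : ℝ, φ x = (c : EReal) := ⟨_, (EReal.coe_toReal htop hbot).symm⟩
  have hle : econj φ p ≤ ((⟪p, x⟫ - c : ℝ) : EReal) := by
    refine econj_le_coe_iff.2 fun y => ?_
    refine le_trans (le_of_eq ?_) (hsub y)
    rw [hc, inner_sub_right]
    norm_cast
    ring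
  refine ⟨ne_top_of_le_ne_top (EReal.coe_ne_top _) hle, econj_ne_bot hφ p, fun q => ?_⟩
  refine (add_le_add_left hle _).trans ?_
  have h1 : ((⟪q, x⟫ : ℝ) : EReal) - φ x ≤ econj φ q :=
    le_iSup (fun x => ((⟪q, x⟫ : ℝ) : EReal) - φ x) x
  refine le_trans (le_of_eq ?_) h1
  rw [hc, real_inner_comm (q - p) x, inner_sub_left]
  norm_cast
  ring

theorem nonneg_of_forall_add_mul_nonneg {a b : ℝ} (hb : 0 ≤ b)
    (h : ∀ t : ℝ, 0 < t → t ≤ 1 → 0 ≤ a + t * b) : 0 ≤ a := by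
  by_contra! ha
  have hb' : 0 < b + 1 := by linarith
  have ht : 0 < min 1 (-a / (b + 1)) := lt_min one_pos (div_pos (by linarith) hb')
  have h1 := h _ ht (min_le_left _ _)
  have h2 : min 1 (-a / (b + 1)) * (b + 1) ≤ -a := by
    rw [← le_div_iff₀ hb']
    exact min_le_right _ _
  nlinarith

/-- The variational characterization of a proximal point, tested against a subgradient. -/
theorem IsProx.inner_nonneg {φ : E → EReal} (hconv : RealSegmentConvex φ) (hbot : ∀ x, φ x ≠ ⊥)
    {γ : ℝ} (hγ : 0 < γ) {w x u s : E} (hx : IsProx γ φ w x) (hs : s ∈ esubdiff φ u) :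
    0 ≤ ⟪w - x - γ • s, x - u⟫ := by
  obtain ⟨hutop, hubot, hsub⟩ := hs
  obtain ⟨b, hb⟩ : ∃ b : ℝ, φ u = (b : EReal) := ⟨_, (EReal.coe_toReal hutop hubot).symm⟩
  have hxtop : φ x ≠ ⊤ := by
    intro htop
    have h1 := hx u
    rw [htop, hb, EReal.coe_mul_top_of_pos hγ, EReal.top_add_coe, top_le_iff] at h1
    exact EReal.coe_ne_top _ (by exact_mod_cast h1)
  obtain ⟨a, ha⟩ : ∃ a : ℝ, φ x = (a : EReal) := ⟨_, (EReal.coe_toReal hxtop (hbot x)).symm⟩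
  have hsub' : b + ⟪s, x - u⟫ ≤ a := by
    have := hsub x
    rw [ha, hb] at this
    exact_mod_cast this
  have key : 0 ≤ γ * (b - a) + ⟪x - w, u - x⟫ := by
    refine nonneg_of_forall_add_mul_nonneg (b := ‖u - x‖ ^ 2 / 2) (by positivity) ?_
    intro t ht0 ht1
    have hseg := hconv x u a b ha hb t ht0.le ht1
    have hprox := hx ((1 - t) • x + t • u)
    obtain ⟨c, hc⟩ : ∃ c : ℝ, φ ((1 - t) • x + t • u) = (c : EReal) :=
      ⟨_, (EReal.coe_toReal (ne_top_of_le_ne_top (EReal.coe_ne_top _) hseg) (hbot _)).symm⟩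
    rw [hc] at hseg hprox
    rw [ha] at hprox
    norm_cast at hseg hprox
    have hexp : ‖(1 - t) • x + t • u - w‖ ^ 2
        = ‖x - w‖ ^ 2 + 2 * t * ⟪x - w, u - x⟫ + t ^ 2 * ‖u - x‖ ^ 2 := by
      have : (1 - t) • x + t • u - w = (x - w) + t • (u - x) := by module
      rw [this, norm_add_sq_real, real_inner_smul_right, norm_smul, mul_pow, Real.norm_eq_abs,
        sq_abs]
      ring
    rw [hexp] at hprox
    have h2 := mul_le_mul_of_nonneg_left hseg hγ.le
    have h3 : 0 ≤ t * (γ * (b - a) + ⟪x - w, u - x⟫ + t * (‖u - x‖ ^ 2 / 2)) := by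
      nlinarith
    exact nonneg_of_mul_nonneg_right h3 ht0
  have hexp : ⟪w - x - γ • s, x - u⟫ = ⟪x - w, u - x⟫ - γ * ⟪s, x - u⟫ := by
    rw [inner_sub_left, real_inner_smul_left, ← neg_sub x w, ← neg_sub x u, inner_neg_left,
      inner_neg_right]
  rw [hexp]
  nlinarith

theorem HasGradientAt.inner_le_sub [CompleteSpace E] {h : E → ℝ} (hconv : ConvexOn ℝ Set.univ h)
    {x d : E} (hd : HasGradientAt h d x) (y : E) : ⟪d, y - x⟫ ≤ h y - h x := by
  have hline : HasDerivAt (fun t : ℝ => h (AffineMap.lineMap x y t)) ⟪d, y - x⟫ 0 := by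
    have h1 : HasFDerivAt h (InnerProductSpace.toDual ℝ E d)
        (AffineMap.lineMap x y (0 : ℝ)) := by simpa using hd.hasFDerivAt
    simpa [Function.comp_def] using
      h1.comp_hasDerivAt (0 : ℝ) (AffineMap.hasDerivAt_lineMap (a := x) (b := y))
  have hc : ConvexOn ℝ Set.univ (fun t : ℝ => h (AffineMap.lineMap x y t)) :=
    hconv.comp_affineMap (AffineMap.lineMap x y)
  have := hc.le_slope_of_hasDerivAt (Set.mem_univ 0) (Set.mem_univ 1) one_pos hline
  simpa [slope] using this

/-- The gradient of a differentiable convex function is monotone. -/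
theorem inner_gradient_sub_nonneg [CompleteSpace E] {h : E → ℝ} {h' : E → E}
    (hconv : ConvexOn ℝ Set.univ h) (hgrad : ∀ x, HasGradientAt h (h' x) x) (x y : E) :
    0 ≤ ⟪h' x - h' y, x - y⟫ := by
  have h1 := (hgrad x).inner_le_sub hconv y
  have h2 := (hgrad y).inner_le_sub hconv x
  rw [inner_sub_left]
  rw [← neg_sub x y, inner_neg_right] at h1
  linarith

theorem ProperConvLsc.convexOn {h : E → ℝ} (hh : ProperConvLsc (fun x => (h x : EReal))) :
    ConvexOn ℝ Set.univ h := by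
  refine ⟨convex_univ, fun x _ y _ a b ha hb hab => ?_⟩
  have := hh.2.2.1 x y a b ha hb hab
  simp only [smul_eq_mul] at this ⊢
  exact_mod_cast this

end ConvexAnalysis

/-- Two sequences whose differences are absolutely summable. -/
def SummablyClose {E : Type*} [NormedAddCommGroup E] (a b : ℕ → E) : Prop :=
  Summable fun n => ‖a n - b n‖

namespace SummablyClose

variable {E : Type*} [NormedAddCommGroup E] {a b c d : ℕ → E}

theorem refl (a : ℕ → E) : SummablyClose a a := by
  simp [SummablyClose]

theorem trans (h₁ : SummablyClose a b) (h₂ : SummablyClose b c) : SummablyClose a c :=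
  Summable.of_nonneg_of_le (fun _ => norm_nonneg _) (fun _ => norm_sub_le_norm_sub_add_norm_sub _ _ _)
    (Summable.add h₁ h₂)

theorem add (h₁ : SummablyClose a b) (h₂ : SummablyClose c d) :
    SummablyClose (fun n => a n + c n) (fun n => b n + d n) :=
  Summable.of_nonneg_of_le (fun _ => norm_nonneg _)
    (fun n => by rw [add_sub_add_comm]; exact norm_add_le _ _) (Summable.add h₁ h₂)

theorem sub (h₁ : SummablyClose a b) (h₂ : SummablyClose c d) :
    SummablyClose (fun n => a n - c n) (fun n => b n - d n) :=
  Summable.of_nonneg_of_le (fun _ => norm_nonneg _)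
    (fun n => by rw [sub_sub_sub_comm]; exact norm_sub_le _ _) (Summable.add h₁ h₂)

theorem smul [NormedSpace ℝ E] {t : ℕ → ℝ} {C : ℝ} (ht : ∀ n, |t n| ≤ C)
    (h : SummablyClose a b) : SummablyClose (fun n => t n • a n) (fun n => t n • b n) :=
  Summable.of_nonneg_of_le (fun _ => norm_nonneg _)
    (fun n => by
      rw [← smul_sub, norm_smul]
      exact mul_le_mul_of_nonneg_right (ht n) (norm_nonneg _)) (Summable.mul_left C h)

theorem comp_lipschitz {F : Type*} [NormedAddCommGroup F] {S : E → F} {C : ℝ}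
    (hS : ∀ x y, ‖S x - S y‖ ≤ C * ‖x - y‖) (h : SummablyClose a b) :
    SummablyClose (fun n => S (a n)) (fun n => S (b n)) :=
  Summable.of_nonneg_of_le (fun _ => norm_nonneg _) (fun _ => hS _ _) (Summable.mul_left C h)

theorem bddAbove (h : SummablyClose a b) : ∃ C, ∀ n, ‖a n - b n‖ ≤ C :=
  ⟨_, fun n => Summable.le_tsum h n fun _ _ => norm_nonneg _⟩

end SummablyClose

/-- A perturbed Fejér-type recursion forces the decrements to be summable. -/
theorem summable_of_perturbed_decrease {a b d η : ℕ → ℝ} (ha : ∀ n, 0 ≤ a n)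
    (hd : ∀ n, 0 ≤ d n) (hη0 : ∀ n, 0 ≤ η n) (hη : Summable η)
    (hstep : ∀ n, a (n + 1) ≤ b n + η n) (hdec : ∀ n, b n ^ 2 ≤ a n ^ 2 - d n) : Summable d := by
  have hba : ∀ n, b n ≤ a n := fun n =>
    abs_le_of_sq_le_sq' (by linarith [hdec n, hd n]) (ha n) |>.2
  have hbound : ∀ n, a n ≤ a 0 + ∑ k ∈ Finset.range n, η k := by
    intro n
    induction n with
    | zero => simp
    | succ n ih =>
      rw [Finset.sum_range_succ]
      linarith [hstep n, hba n]
  have hsum : ∀ n, ∑ k ∈ Finset.range n, η k ≤ ∑' k, η k := fun n =>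
    hη.sum_le_tsum _ fun k _ => hη0 k
  set B := a 0 + ∑' k, η k with hB
  have haB : ∀ n, a n ≤ B := fun n => by linarith [hbound n, hsum n]
  have hB0 : 0 ≤ B := (ha 0).trans (haB 0)
  have htel : ∀ n, ∑ k ∈ Finset.range n, d k + a n ^ 2
      ≤ a 0 ^ 2 + 3 * B * ∑ k ∈ Finset.range n, η k := by
    intro n
    induction n with
    | zero => simp
    | succ n ih =>
      rw [Finset.sum_range_succ, Finset.sum_range_succ]
      have hηB : η n ≤ B := by
        linarith [hη.le_tsum n fun k _ => hη0 k, ha 0]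
      have h1 : a (n + 1) ^ 2 ≤ (b n + η n) ^ 2 :=
        pow_le_pow_left₀ (ha _) (hstep n) 2
      have h2 : b n * η n ≤ B * η n :=
        mul_le_mul_of_nonneg_right ((hba n).trans (haB n)) (hη0 n)
      have h3 : η n * η n ≤ B * η n := mul_le_mul_of_nonneg_right hηB (hη0 n)
      nlinarith [hdec n]
  refine summable_of_sum_range_le hd (c := a 0 ^ 2 + 3 * B * ∑' k, η k) fun n => ?_
  have := mul_le_mul_of_nonneg_left (hsum n) (by positivity : 0 ≤ 3 * B)
  nlinarith [htel n, sq_nonneg (a n)]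

section ForwardBackwardForward

variable {W : Type*} [NormedAddCommGroup W] [InnerProductSpace ℝ W]

theorem norm_forward_backward_forward_sq_le {S : W → W} {β : ℝ}
    (hS : ∀ a b, ‖S a - S b‖ ≤ β * ‖a - b‖) {γ : ℝ} {w wh ws : W}
    (hmono : 0 ≤ ⟪w - γ • S w - wh + γ • S wh, wh - ws⟫) :
    ‖wh + γ • (S w - S wh) - ws‖ ^ 2
      ≤ ‖w - ws‖ ^ 2 - (1 - (γ * β) ^ 2) * ‖w - wh‖ ^ 2 := by
  have e1 : wh + γ • (S w - S wh) - ws = (wh - ws) + γ • (S w - S wh) := by abel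
  have e2 : w - ws = (wh - ws) + (w - wh) := by abel
  have e3 : w - γ • S w - wh + γ • S wh = (w - wh) - γ • (S w - S wh) := by module
  rw [e3, inner_sub_left, real_inner_comm, real_inner_comm (wh - ws) (γ • _)] at hmono
  rw [e1, e2, norm_add_sq_real, norm_add_sq_real (wh - ws) (w - wh), norm_smul, mul_pow,
    Real.norm_eq_abs, sq_abs]
  have h1 := mul_le_mul_of_nonneg_left
    (pow_le_pow_left₀ (norm_nonneg _) (hS w wh) 2) (sq_nonneg γ)
  nlinarith

/-- Summability of the squared residuals of Tseng's forward-backward-forward iteration with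
summable errors; `wh n` stands for the exact backward step. -/
theorem summable_forward_backward_forward_residual {S : W → W} {β : ℝ} (hβ : 0 < β)
    (hS : ∀ a b, ‖S a - S b‖ ≤ β * ‖a - b‖) {ε : ℝ} (hε0 : 0 < ε) (hε1 : ε < 1)
    {γ : ℕ → ℝ} (hγ0 : ∀ n, 0 ≤ γ n) (hγ : ∀ n, γ n ≤ (1 - ε) / β)
    {w wt wh : ℕ → W} {ws : W} (hwt : SummablyClose wt wh)
    (hw : SummablyClose (fun n => w (n + 1)) fun n => wt n + γ n • (S (w n) - S (wt n)))
    (hmono : ∀ n, 0 ≤ ⟪w n - γ n • S (w n) - wh n + γ n • S (wh n), wh n - ws⟫) :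
    Summable fun n => ‖w n - wt n‖ ^ 2 := by
  have hγabs : ∀ n, |γ n| ≤ (1 - ε) / β := fun n => (abs_of_nonneg (hγ0 n)).trans_le (hγ n)
  have hγβ : ∀ n, γ n * β ≤ 1 - ε := fun n => (le_div_iff₀ hβ).1 (hγ n)
  have hnext : SummablyClose (fun n => w (n + 1))
      fun n => wh n + γ n • (S (w n) - S (wh n)) :=
    hw.trans (hwt.add (((SummablyClose.refl _).sub (hwt.comp_lipschitz hS)).smul hγabs))
  have hc : 0 < 1 - (1 - ε) ^ 2 := by nlinarith
  have hd : Summable fun n => (1 - (1 - ε) ^ 2) * ‖w n - wh n‖ ^ 2 := by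
    refine summable_of_perturbed_decrease (a := fun n => ‖w n - ws‖)
      (b := fun n => ‖wh n + γ n • (S (w n) - S (wh n)) - ws‖) (fun _ => norm_nonneg _)
      (fun _ => by positivity) (fun _ => norm_nonneg _) hnext
      (fun n => ?_) (fun n => ?_)
    · exact (norm_sub_le_norm_sub_add_norm_sub _ _ _).trans_eq (add_comm _ _)
    · have h1 : (γ n * β) ^ 2 ≤ (1 - ε) ^ 2 :=
        pow_le_pow_left₀ (mul_nonneg (hγ0 n) hβ.le) (hγβ n) 2
      have h2 := norm_forward_backward_forward_sq_le hS (hmono n)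
      nlinarith [mul_le_mul_of_nonneg_right h1 (sq_nonneg ‖w n - wh n‖)]
  have hd' : Summable fun n => ‖w n - wh n‖ ^ 2 := (summable_mul_left_iff hc.ne').1 hd
  obtain ⟨C, hC⟩ := hwt.bddAbove
  refine Summable.of_nonneg_of_le (fun _ => by positivity) (fun n => ?_)
    ((hd'.mul_left 2).add (Summable.mul_left (2 * C) hwt))
  have h1 : ‖w n - wt n‖ ≤ ‖w n - wh n‖ + ‖wt n - wh n‖ := by
    rw [norm_sub_rev (wt n)]
    exact norm_sub_le_norm_sub_add_norm_sub _ _ _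
  have h2 := pow_le_pow_left₀ (norm_nonneg _) h1 2
  have h3 := mul_le_mul_of_nonneg_right (hC n) (norm_nonneg (wt n - wh n))
  nlinarith [sq_nonneg (‖w n - wh n‖ - ‖wt n - wh n‖)]

end ForwardBackwardForward

section ProductSpace

set_option linter.unusedSectionVars false

variable {ι : Type*} [Fintype ι]
  {H : Type*} [NormedAddCommGroup H] [InnerProductSpace ℝ H]
  {X : ι → Type*} [∀ i, NormedAddCommGroup (X i)] [∀ i, InnerProductSpace ℝ (X i)]
  {Y : ι → Type*} [∀ i, NormedAddCommGroup (Y i)] [∀ i, InnerProductSpace ℝ (Y i)]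
  {G : ι → Type*} [∀ i, NormedAddCommGroup (G i)] [∀ i, InnerProductSpace ℝ (G i)]

/-- The Hilbert direct sum of `H` and of all `X i`, `Y i` and three copies of `G i`. -/
def PrimalDualSpace (H : Type*) (X Y G : ι → Type*) :=
  WithLp 2 (H × PiLp 2 fun i =>
    WithLp 2 (X i × WithLp 2 (Y i × WithLp 2 (G i × WithLp 2 (G i × G i)))))

instance : NormedAddCommGroup (PrimalDualSpace H X Y G) :=
  inferInstanceAs (NormedAddCommGroup (WithLp 2 (H × PiLp 2 fun i =>
    WithLp 2 (X i × WithLp 2 (Y i × WithLp 2 (G i × WithLp 2 (G i × G i)))))))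

instance : InnerProductSpace ℝ (PrimalDualSpace H X Y G) :=
  inferInstanceAs (InnerProductSpace ℝ (WithLp 2 (H × PiLp 2 fun i =>
    WithLp 2 (X i × WithLp 2 (Y i × WithLp 2 (G i × WithLp 2 (G i × G i)))))))

/-- The point of `PrimalDualSpace` with the given components. -/
def primalDual (x : H) (p : ∀ i, X i) (q : ∀ i, Y i) (z y v : ∀ i, G i) :
    PrimalDualSpace H X Y G :=
  WithLp.toLp 2 (x, WithLp.toLp 2 fun i => WithLp.toLp 2
    (p i, WithLp.toLp 2 (q i, WithLp.toLp 2 (z i, WithLp.toLp 2 (y i, v i)))))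

theorem exists_eq_primalDual (w : PrimalDualSpace H X Y G) :
    ∃ x p q z y v, w = primalDual x p q z y v :=
  ⟨w.fst, fun i => (w.snd i).fst, fun i => (w.snd i).snd.fst, fun i => (w.snd i).snd.snd.fst,
    fun i => (w.snd i).snd.snd.snd.fst, fun i => (w.snd i).snd.snd.snd.snd, rfl⟩

variable (x x' : H) (p p' : ∀ i, X i) (q q' : ∀ i, Y i) (z z' y y' v v' : ∀ i, G i)

theorem primalDual_add :
    primalDual x p q z y v + primalDual x' p' q' z' y' v' =
      primalDual (x + x') (p + p') (q + q') (z + z') (y + y') (v + v') := rfl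

theorem primalDual_sub :
    primalDual x p q z y v - primalDual x' p' q' z' y' v' =
      primalDual (x - x') (p - p') (q - q') (z - z') (y - y') (v - v') := rfl

theorem smul_primalDual (c : ℝ) :
    c • primalDual x p q z y v = primalDual (c • x) (c • p) (c • q) (c • z) (c • y) (c • v) := rfl

theorem inner_primalDual :
    ⟪primalDual x p q z y v, primalDual x' p' q' z' y' v'⟫ = ⟪x, x'⟫ + ∑ i,
      (⟪p i, p' i⟫ + ⟪q i, q' i⟫ + ⟪z i, z' i⟫ + ⟪y i, y' i⟫ + ⟪v i, v' i⟫) := by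
  refine (WithLp.prod_inner_apply (𝕜 := ℝ) (WithLp.toLp 2 (x, _)) (WithLp.toLp 2 (x', _))).trans ?_
  simp [WithLp.prod_inner_apply, PiLp.inner_apply, add_assoc]

theorem norm_primalDual_sq :
    ‖primalDual x p q z y v‖ ^ 2 = ‖x‖ ^ 2 + ∑ i,
      (‖p i‖ ^ 2 + ‖q i‖ ^ 2 + ‖z i‖ ^ 2 + ‖y i‖ ^ 2 + ‖v i‖ ^ 2) := by
  simp only [← real_inner_self_eq_norm_sq, inner_primalDual]

theorem norm_primalDual_le :
    ‖primalDual x p q z y v‖ ≤ ‖x‖ + ∑ i, (‖p i‖ + ‖q i‖ + ‖z i‖ + ‖y i‖ + ‖v i‖) := by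
  refine le_of_sq_le_sq ?_ (by positivity)
  rw [norm_primalDual_sq]
  have hpos : ∀ i, 0 ≤ ‖p i‖ + ‖q i‖ + ‖z i‖ + ‖y i‖ + ‖v i‖ := fun i => by positivity
  have h1 : ∑ i, (‖p i‖ ^ 2 + ‖q i‖ ^ 2 + ‖z i‖ ^ 2 + ‖y i‖ ^ 2 + ‖v i‖ ^ 2)
      ≤ ∑ i, (‖p i‖ + ‖q i‖ + ‖z i‖ + ‖y i‖ + ‖v i‖) ^ 2 := by
    refine Finset.sum_le_sum fun i _ => ?_
    rw [← sub_nonneg]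
    ring_nf
    positivity
  have h2 := Finset.sum_sq_le_sq_sum_of_nonneg (s := Finset.univ) fun i _ => hpos i
  nlinarith [mul_nonneg (norm_nonneg x) (Finset.sum_nonneg fun i (_ : i ∈ Finset.univ) => hpos i)]

theorem norm_sq_le_norm_primalDual_sq : ‖x‖ ^ 2 ≤ ‖primalDual x p q z y v‖ ^ 2 := by
  rw [norm_primalDual_sq]
  exact le_add_of_nonneg_right (by positivity)

theorem norm_sq_add_norm_sq_le_norm_primalDual_sq (i : ι) :
    ‖p i‖ ^ 2 + ‖q i‖ ^ 2 ≤ ‖primalDual x p q z y v‖ ^ 2 := by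
  rw [norm_primalDual_sq]
  have h1 := Finset.single_le_sum (s := Finset.univ)
    (f := fun i => ‖p i‖ ^ 2 + ‖q i‖ ^ 2 + ‖z i‖ ^ 2 + ‖y i‖ ^ 2 + ‖v i‖ ^ 2)
    (fun i _ => by positivity) (Finset.mem_univ i)
  nlinarith [sq_nonneg ‖x‖, sq_nonneg ‖z i‖, sq_nonneg ‖y i‖, sq_nonneg ‖v i‖]

theorem SummablyClose.toPrimalDual {x x' : ℕ → H} {p p' : ℕ → ∀ i, X i} {q q' : ℕ → ∀ i, Y i}
    {z z' y y' v v' : ℕ → ∀ i, G i} (hx : SummablyClose x x')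
    (hp : ∀ i, SummablyClose (fun n => p n i) fun n => p' n i)
    (hq : ∀ i, SummablyClose (fun n => q n i) fun n => q' n i)
    (hz : ∀ i, SummablyClose (fun n => z n i) fun n => z' n i)
    (hy : ∀ i, SummablyClose (fun n => y n i) fun n => y' n i)
    (hv : ∀ i, SummablyClose (fun n => v n i) fun n => v' n i) :
    SummablyClose (fun n => primalDual (x n) (p n) (q n) (z n) (y n) (v n))
      fun n => primalDual (x' n) (p' n) (q' n) (z' n) (y' n) (v' n) := by
  have hsum : Summable fun n => ‖x n - x' n‖ + ∑ i, (‖p n i - p' n i‖ + ‖q n i - q' n i‖ +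
      ‖z n i - z' n i‖ + ‖y n i - y' n i‖ + ‖v n i - v' n i‖) :=
    Summable.add hx (summable_sum fun i _ =>
      Summable.add (Summable.add (Summable.add (Summable.add (hp i) (hq i)) (hz i)) (hy i)) (hv i))
  refine Summable.of_nonneg_of_le (fun _ => norm_nonneg _) (fun n => ?_) hsum
  rw [primalDual_sub]
  exact norm_primalDual_le _ _ _ _ _ _

variable [CompleteSpace H] [∀ i, CompleteSpace (X i)] [∀ i, CompleteSpace (Y i)]
  [∀ i, CompleteSpace (G i)]
  (L : ∀ i, H →L[ℝ] G i) (K : ∀ i, G i →L[ℝ] X i) (M : ∀ i, G i →L[ℝ] Y i)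

open ContinuousLinearMap (adjoint)

/-- The skew-adjoint linear part of the forward operator. -/
def skewOperator (w : PrimalDualSpace H X Y G) : PrimalDualSpace H X Y G :=
  primalDual (∑ i, adjoint (L i) (w.snd i).snd.snd.snd.snd)
    (fun i => -K i (w.snd i).snd.snd.fst) (fun i => -M i (w.snd i).snd.snd.snd.fst)
    (fun i => adjoint (K i) (w.snd i).fst) (fun i => adjoint (M i) (w.snd i).snd.fst)
    (fun i => -L i w.fst)

/-- The Lipschitzian monotone operator handled by the forward steps. -/
def forwardOperator (h' : H → H) (w : PrimalDualSpace H X Y G) : PrimalDualSpace H X Y G :=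
  primalDual (h' w.fst) 0 0 0 0 0 + skewOperator L K M w

theorem skewOperator_primalDual :
    skewOperator L K M (primalDual x p q z y v) =
      primalDual (∑ i, adjoint (L i) (v i)) (fun i => -K i (z i)) (fun i => -M i (y i))
        (fun i => adjoint (K i) (p i)) (fun i => adjoint (M i) (q i)) (fun i => -L i x) := rfl

theorem forwardOperator_primalDual (h' : H → H) :
    forwardOperator L K M h' (primalDual x p q z y v) =
      primalDual (h' x + ∑ i, adjoint (L i) (v i)) (fun i => -K i (z i)) (fun i => -M i (y i))
        (fun i => adjoint (K i) (p i)) (fun i => adjoint (M i) (q i)) (fun i => -L i x) := by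
  rw [forwardOperator, skewOperator_primalDual, primalDual_add]
  simp only [zero_add]
  rfl

theorem skewOperator_sub (a b : PrimalDualSpace H X Y G) :
    skewOperator L K M (a - b) = skewOperator L K M a - skewOperator L K M b := by
  obtain ⟨x, p, q, z, y, v, rfl⟩ := exists_eq_primalDual a
  obtain ⟨x', p', q', z', y', v', rfl⟩ := exists_eq_primalDual b
  simp only [primalDual_sub, skewOperator_primalDual, Pi.sub_apply, map_sub,
    Finset.sum_sub_distrib, neg_sub]
  congr 1 <;> ext i <;> simp [neg_add_eq_sub]

theorem ContinuousLinearMap.norm_apply_sq_le {E F : Type*} [NormedAddCommGroup E]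
    [NormedSpace ℝ E] [NormedAddCommGroup F] [NormedSpace ℝ F] (T : E →L[ℝ] F) (a : E) :
    ‖T a‖ ^ 2 ≤ ‖T‖ ^ 2 * ‖a‖ ^ 2 := by
  rw [← mul_pow]
  exact pow_le_pow_left₀ (norm_nonneg _) (T.le_opNorm a) 2

theorem norm_sum_adjoint_sq_le :
    ‖∑ i, adjoint (L i) (v i)‖ ^ 2 ≤ (∑ i, ‖L i‖ ^ 2) * ∑ i, ‖v i‖ ^ 2 := by
  have h1 : ‖∑ i, adjoint (L i) (v i)‖ ≤ ∑ i, ‖L i‖ * ‖v i‖ := by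
    refine (norm_sum_le _ _).trans (Finset.sum_le_sum fun i _ => ?_)
    simpa using (adjoint (L i)).le_opNorm (v i)
  exact (pow_le_pow_left₀ (norm_nonneg _) h1 2).trans (Finset.sum_mul_sq_le_sq_mul_sq _ _ _)

variable {L K M}

theorem norm_skewOperator_le {s : ℝ} (hL : ∑ i, ‖L i‖ ^ 2 ≤ s) (hK : ∀ i, ‖K i‖ ^ 2 ≤ s)
    (hM : ∀ i, ‖M i‖ ^ 2 ≤ s) (w : PrimalDualSpace H X Y G) :
    ‖skewOperator L K M w‖ ≤ √s * ‖w‖ := by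
  have hs : 0 ≤ s := le_trans (by positivity) hL
  obtain ⟨x, p, q, z, y, v, rfl⟩ := exists_eq_primalDual w
  refine le_of_sq_le_sq ?_ (by positivity)
  rw [mul_pow, Real.sq_sqrt hs, skewOperator_primalDual, norm_primalDual_sq, norm_primalDual_sq]
  simp only [norm_neg]
  have h1 : ‖∑ i, adjoint (L i) (v i)‖ ^ 2 ≤ s * ∑ i, ‖v i‖ ^ 2 :=
    (norm_sum_adjoint_sq_le v L).trans (mul_le_mul_of_nonneg_right hL (by positivity))
  have h2 : ∀ i, ‖K i (z i)‖ ^ 2 ≤ s * ‖z i‖ ^ 2 := fun i =>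
    ((K i).norm_apply_sq_le (z i)).trans (mul_le_mul_of_nonneg_right (hK i) (sq_nonneg _))
  have h3 : ∀ i, ‖M i (y i)‖ ^ 2 ≤ s * ‖y i‖ ^ 2 := fun i =>
    ((M i).norm_apply_sq_le (y i)).trans (mul_le_mul_of_nonneg_right (hM i) (sq_nonneg _))
  have h4 : ∀ i, ‖adjoint (K i) (p i)‖ ^ 2 ≤ s * ‖p i‖ ^ 2 := fun i =>
    ((adjoint (K i)).norm_apply_sq_le (p i)).trans
      (mul_le_mul_of_nonneg_right (by simpa using hK i) (sq_nonneg _))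
  have h5 : ∀ i, ‖adjoint (M i) (q i)‖ ^ 2 ≤ s * ‖q i‖ ^ 2 := fun i =>
    ((adjoint (M i)).norm_apply_sq_le (q i)).trans
      (mul_le_mul_of_nonneg_right (by simpa using hM i) (sq_nonneg _))
  have h6 : ∑ i, ‖L i x‖ ^ 2 ≤ s * ‖x‖ ^ 2 := by
    refine le_trans (Finset.sum_le_sum fun i _ => (L i).norm_apply_sq_le x) ?_
    rw [← Finset.sum_mul]
    exact mul_le_mul_of_nonneg_right hL (sq_nonneg _)
  have h7 : ∑ i, (‖K i (z i)‖ ^ 2 + ‖M i (y i)‖ ^ 2 + ‖adjoint (K i) (p i)‖ ^ 2 +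
      ‖adjoint (M i) (q i)‖ ^ 2) ≤
      ∑ i, s * (‖p i‖ ^ 2 + ‖q i‖ ^ 2 + ‖z i‖ ^ 2 + ‖y i‖ ^ 2) :=
    Finset.sum_le_sum fun i _ => by linarith [h2 i, h3 i, h4 i, h5 i]
  rw [← Finset.mul_sum] at h7
  rw [Finset.sum_add_distrib, Finset.sum_add_distrib (g := fun i => ‖v i‖ ^ 2)]
  linarith

theorem norm_forwardOperator_sub_le {h' : H → H} {μ : ℝ} (hμ : 0 ≤ μ)
    (hlip : ∀ x y, ‖h' x - h' y‖ ≤ μ * ‖x - y‖)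
    {s : ℝ} (hL : ∑ i, ‖L i‖ ^ 2 ≤ s) (hK : ∀ i, ‖K i‖ ^ 2 ≤ s)
    (hM : ∀ i, ‖M i‖ ^ 2 ≤ s) (a b : PrimalDualSpace H X Y G) :
    ‖forwardOperator L K M h' a - forwardOperator L K M h' b‖ ≤ (μ + √s) * ‖a - b‖ := by
  have h0 := norm_skewOperator_le hL hK hM (a - b)
  have heq : forwardOperator L K M h' a - forwardOperator L K M h' b =
      primalDual (h' a.fst - h' b.fst) 0 0 0 0 0 + skewOperator L K M (a - b) := by
    rw [skewOperator_sub, forwardOperator, forwardOperator, add_sub_add_comm, primalDual_sub]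
    simp only [sub_zero]
  have h1 : ‖(primalDual (h' a.fst - h' b.fst) 0 0 0 0 0 : PrimalDualSpace H X Y G)‖
      ≤ μ * ‖a - b‖ := by
    obtain ⟨x, p, q, z, y, v, rfl⟩ := exists_eq_primalDual a
    obtain ⟨x', p', q', z', y', v', rfl⟩ := exists_eq_primalDual b
    have h1 := norm_primalDual_le (X := X) (Y := Y) (G := G) (h' x - h' x') 0 0 0 0 0
    have h2 := le_of_sq_le_sq (norm_sq_le_norm_primalDual_sq (x - x') (p - p') (q - q') (z - z')
      (y - y') (v - v')) (norm_nonneg _)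
    simp only [Pi.zero_apply, norm_zero, add_zero, Finset.sum_const_zero] at h1
    exact h1.trans ((hlip _ _).trans (mul_le_mul_of_nonneg_left h2 hμ))
  rw [heq, add_mul]
  exact norm_add_le_of_le h1 h0

end ProductSpace

section DualStep

theorem resolvent_eqs {F : Type*} [AddCommGroup F] [Module ℝ F] (c : ℝ) (hc : 0 ≤ c)
    {a b z y : F} (hz : z = ((1 + c) / (1 + 2 * c)) • (a - (c / (1 + c)) • b))
    (hy : y = (1 / (1 + c)) • (b - c • z)) :
    z + c • (z + y) = a ∧ y + c • (z + y) = b := by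
  have h1 : 1 + c ≠ 0 := by positivity
  have h2 : 1 + 2 * c ≠ 0 := by positivity
  subst hy
  subst hz
  constructor <;> match_scalars <;> field_simp <;> ring

/-- The inexact dual step follows an exact resolvent step up to summable errors. -/
theorem exists_exact_dual_step {F : Type*} [NormedAddCommGroup F] [NormedSpace ℝ F]
    {γ : ℕ → ℝ} {C : ℝ} (hγ : ∀ n, |γ n| ≤ C)
    {z y v k m l u1 u2 zt yt vt : ℕ → F}
    (hu1 : SummablyClose u1 fun n => z n - γ n • (k n - v n - γ n • l n))
    (hu2 : SummablyClose u2 fun n => y n - γ n • (m n - v n - γ n • l n))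
    (hzt : SummablyClose zt fun n => ((1 + γ n ^ 2) / (1 + 2 * γ n ^ 2)) •
      (u1 n - (γ n ^ 2 / (1 + γ n ^ 2)) • u2 n))
    (hyt : SummablyClose yt fun n => (1 / (1 + γ n ^ 2)) • (u2 n - γ n ^ 2 • zt n))
    (hvt : SummablyClose vt fun n => v n + γ n • (l n - zt n - yt n)) :
    ∃ zh yh vh : ℕ → F, SummablyClose zt zh ∧ SummablyClose yt yh ∧ SummablyClose vt vh ∧
      (∀ n, z n - γ n • k n - zh n = -(γ n • vh n)) ∧
      (∀ n, y n - γ n • m n - yh n = -(γ n • vh n)) ∧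
      ∀ n, v n + γ n • l n - vh n = γ n • (zh n + yh n) := by
  have b1 : ∀ n, |(1 + γ n ^ 2) / (1 + 2 * γ n ^ 2)| ≤ 1 := fun n => by
    rw [abs_of_nonneg (by positivity), div_le_one (by positivity)]
    nlinarith [sq_nonneg (γ n)]
  have b2 : ∀ n, |γ n ^ 2 / (1 + γ n ^ 2)| ≤ 1 := fun n => by
    rw [abs_of_nonneg (by positivity), div_le_one (by positivity)]
    linarith
  have b3 : ∀ n, |1 / (1 + γ n ^ 2)| ≤ 1 := fun n => by
    rw [abs_of_nonneg (by positivity), div_le_one (by positivity)]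
    nlinarith [sq_nonneg (γ n)]
  have b4 : ∀ n, |γ n ^ 2| ≤ C ^ 2 := fun n => by
    rw [abs_pow]
    exact pow_le_pow_left₀ (abs_nonneg _) (hγ n) 2
  obtain ⟨a, ha⟩ : ∃ a : ℕ → F, ∀ n, a n = z n - γ n • (k n - v n - γ n • l n) :=
    ⟨_, fun _ => rfl⟩
  obtain ⟨b, hb⟩ : ∃ b : ℕ → F, ∀ n, b n = y n - γ n • (m n - v n - γ n • l n) :=
    ⟨_, fun _ => rfl⟩
  obtain ⟨zh, hzh⟩ : ∃ zh : ℕ → F, ∀ n, zh n =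
      ((1 + γ n ^ 2) / (1 + 2 * γ n ^ 2)) • (a n - (γ n ^ 2 / (1 + γ n ^ 2)) • b n) :=
    ⟨_, fun _ => rfl⟩
  obtain ⟨yh, hyh⟩ : ∃ yh : ℕ → F, ∀ n, yh n = (1 / (1 + γ n ^ 2)) • (b n - γ n ^ 2 • zh n) :=
    ⟨_, fun _ => rfl⟩
  simp only [← ha, ← hb] at hu1 hu2
  have hz' : SummablyClose zt zh := by
    rw [funext hzh]
    exact hzt.trans ((hu1.sub (hu2.smul b2)).smul b1)
  have hy' : SummablyClose yt yh := by
    rw [funext hyh]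
    exact hyt.trans ((hu2.sub (hz'.smul b4)).smul b3)
  have hv' : SummablyClose vt fun n => v n + γ n • (l n - zh n - yh n) :=
    hvt.trans ((SummablyClose.refl v).add ((((SummablyClose.refl l).sub hz').sub hy').smul hγ))
  refine ⟨zh, yh, _, hz', hy', hv', fun n => ?_, fun n => ?_, fun n => by module⟩
  · have h1 := (resolvent_eqs (γ n ^ 2) (sq_nonneg _) (hzh n) (hyh n)).1
    rw [ha, ← sub_eq_zero] at h1
    rw [← sub_eq_zero, ← neg_eq_zero, ← h1]
    module
  · have h1 := (resolvent_eqs (γ n ^ 2) (sq_nonneg _) (hzh n) (hyh n)).2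
    rw [hb, ← sub_eq_zero] at h1
    rw [← sub_eq_zero, ← neg_eq_zero, ← h1]
    module

open ContinuousLinearMap (adjoint)

theorem inner_dual_block_eq {H X Y G : Type*}
    [NormedAddCommGroup H] [InnerProductSpace ℝ H]
    [NormedAddCommGroup X] [InnerProductSpace ℝ X] [CompleteSpace X]
    [NormedAddCommGroup Y] [InnerProductSpace ℝ Y] [CompleteSpace Y]
    [NormedAddCommGroup G] [InnerProductSpace ℝ G] [CompleteSpace G]
    (L : H →L[ℝ] G) (K : G →L[ℝ] X) (M : G →L[ℝ] Y) (γ : ℝ) {r : G}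
    {x xh xs : H} {p ph ps : X} {q qh qs : Y} {z zh zs y yh ys v vh vs : G}
    (hz : z - γ • adjoint K p - zh = -(γ • vh)) (hy : y - γ • adjoint M q - yh = -(γ • vh))
    (hv : v + γ • (L x - r) - vh = γ • (zh + yh))
    (hps : adjoint K ps = vs) (hqs : adjoint M qs = vs) (hs : L xs - r = zs + ys) :
    ⟪p - γ • (-K z) - ph + γ • (-K zh), ph - ps⟫ + ⟪q - γ • (-M y) - qh + γ • (-M yh), qh - qs⟫
      + ⟪z - γ • adjoint K p - zh + γ • adjoint K ph, zh - zs⟫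
      + ⟪y - γ • adjoint M q - yh + γ • adjoint M qh, yh - ys⟫
      + ⟪v - γ • (-L x) - vh + γ • (-L xh), vh - vs⟫
    = ⟪p + γ • K z - ph - γ • K zs, ph - ps⟫ + ⟪q + γ • M y - qh - γ • M ys, qh - qs⟫
      - γ * ⟪vh - vs, L (xh - xs)⟫ := by
  have e1 : p - γ • (-K z) - ph + γ • (-K zh)
      = (p + γ • K z - ph - γ • K zs) - γ • K (zh - zs) := by rw [map_sub]; module
  have e2 : q - γ • (-M y) - qh + γ • (-M yh)
      = (q + γ • M y - qh - γ • M ys) - γ • M (yh - ys) := by rw [map_sub]; module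
  have e3 : z - γ • adjoint K p - zh + γ • adjoint K ph
      = γ • (adjoint K (ph - ps) - (vh - vs)) := by rw [hz, map_sub, hps]; module
  have e4 : y - γ • adjoint M q - yh + γ • adjoint M qh
      = γ • (adjoint M (qh - qs) - (vh - vs)) := by rw [hy, map_sub, hqs]; module
  have e5 : v - γ • (-L x) - vh + γ • (-L xh)
      = γ • ((zh - zs) + (yh - ys) - L (xh - xs)) := by
    have h1 : v - γ • (-L x) - vh + γ • (-L xh)
        = (v + γ • (L x - r) - vh) + γ • (L xs - L xh - (L xs - r)) := by module
    rw [h1, hv, hs, map_sub]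
    module
  rw [e1, e2, e3, e4, e5, inner_sub_left (_ - γ • K zs), inner_sub_left (_ - γ • M ys)]
  simp only [real_inner_smul_left]
  rw [inner_sub_left (adjoint K _), inner_sub_left (adjoint M _), inner_sub_left (_ + _),
    inner_add_left (zh - zs), ContinuousLinearMap.adjoint_inner_left,
    ContinuousLinearMap.adjoint_inner_left, real_inner_comm (ph - ps) (K _),
    real_inner_comm (qh - qs) (M _), real_inner_comm (vh - vs) (zh - zs),
    real_inner_comm (vh - vs) (yh - ys), real_inner_comm (vh - vs) (L _)]
  ring

end DualStep

theorem stmt15 {m : ℕ}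
    {H : Type*} [NormedAddCommGroup H] [InnerProductSpace ℝ H] [CompleteSpace H]
    {G : Fin m → Type*} [∀ i, NormedAddCommGroup (G i)] [∀ i, InnerProductSpace ℝ (G i)]
    [∀ i, CompleteSpace (G i)]
    {X : Fin m → Type*} [∀ i, NormedAddCommGroup (X i)] [∀ i, InnerProductSpace ℝ (X i)]
    [∀ i, CompleteSpace (X i)]
    {Y : Fin m → Type*} [∀ i, NormedAddCommGroup (Y i)] [∀ i, InnerProductSpace ℝ (Y i)]
    [∀ i, CompleteSpace (Y i)]
    (z : H)
    (f : H → EReal) (hf : ProperConvLsc f)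
    (μ : ℝ) (hμ : 0 < μ)
    (h : H → ℝ) (hh : ProperConvLsc (fun x => (h x : EReal)))
    (h' : H → H) (hgrad : ∀ x, HasGradientAt h (h' x) x)
    (hlip : ∀ x y : H, ‖h' x - h' y‖ ≤ μ * ‖x - y‖)
    (r : ∀ i, G i)
    (g : ∀ i, X i → EReal) (hg : ∀ i, ProperConvLsc (g i))
    (l : ∀ i, Y i → EReal) (hl : ∀ i, ProperConvLsc (l i))
    (L : ∀ i, H →L[ℝ] G i) (hL : ∀ i, L i ≠ 0)
    (K : ∀ i, G i →L[ℝ] X i) (hK : ∀ i, K i ≠ 0)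
    (M : ∀ i, G i →L[ℝ] Y i) (hM : ∀ i, M i ≠ 0)
    -- range condition
    (hran : ∃ (x : H) (u : H) (w : ∀ i, G i), u ∈ esubdiff f x ∧
        (∀ i, w i ∈ parOp (compOp (K i) (esubdiff (g i))) (compOp (M i) (esubdiff (l i)))
          (L i x - r i)) ∧
        z = u + ∑ i, ContinuousLinearMap.adjoint (L i) (w i) + h' x)
    -- the constant β
    (β : ℝ)
    (hβ : ∃ s : ℝ, IsGreatest ({∑ i, ‖L i‖ ^ 2} ∪ Set.range (fun j => ‖K j‖ ^ 2) ∪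
        Set.range (fun j => ‖M j‖ ^ 2)) s ∧ β = μ + Real.sqrt s)
    -- step sizes
    (ε : ℝ) (hε : ε ∈ Set.Ioo (0:ℝ) (1 / (β + 1)))
    (γ : ℕ → ℝ) (hγ : ∀ n, γ n ∈ Set.Icc ε ((1 - ε) / β))
    -- the sequences generated by Algorithm 4.6
    (x xt : ℕ → H)
    (p pt : ℕ → ∀ i, X i) (q qt : ℕ → ∀ i, Y i)
    (zz zt y yt v vt u1 u2 : ℕ → ∀ i, G i)
    (hxt : ∃ j : ℕ → H,
      (∀ n, IsProx (γ n) f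
        (x n - γ n • (h' (x n) + ∑ i, ContinuousLinearMap.adjoint (L i) (v n i) - z)) (j n)) ∧
      Summable (fun n => ‖xt n - j n‖))
    (hpt : ∀ i, ∃ j : ℕ → X i,
      (∀ n, IsProx (γ n) (econj (g i)) (p n i + γ n • K i (zz n i)) (j n)) ∧
      Summable (fun n => ‖pt n i - j n‖))
    (hqt : ∀ i, ∃ j : ℕ → Y i,
      (∀ n, IsProx (γ n) (econj (l i)) (q n i + γ n • M i (y n i)) (j n)) ∧
      Summable (fun n => ‖qt n i - j n‖))
    (hu1 : ∀ i, Summable (fun n => ‖u1 n i - (zz n i - γ n •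
        (ContinuousLinearMap.adjoint (K i) (p n i) - v n i - γ n • (L i (x n) - r i)))‖))
    (hu2 : ∀ i, Summable (fun n => ‖u2 n i - (y n i - γ n •
        (ContinuousLinearMap.adjoint (M i) (q n i) - v n i - γ n • (L i (x n) - r i)))‖))
    (hzt : ∀ i, Summable (fun n => ‖zt n i -
        ((1 + γ n ^ 2) / (1 + 2 * γ n ^ 2)) •
          (u1 n i - (γ n ^ 2 / (1 + γ n ^ 2)) • u2 n i)‖))
    (hyt : ∀ i, Summable (fun n => ‖yt n i -
        (1 / (1 + γ n ^ 2)) • (u2 n i - γ n ^ 2 • zt n i)‖))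
    (hvt : ∀ i, Summable (fun n => ‖vt n i -
        (v n i + γ n • (L i (x n) - r i - zt n i - yt n i))‖))
    (hx : Summable (fun n => ‖x (n+1) - (xt n + γ n • (h' (x n) - h' (xt n) +
        ∑ i, ContinuousLinearMap.adjoint (L i) (v n i - vt n i)))‖))
    (hp : ∀ i, Summable (fun n => ‖p (n+1) i - (pt n i - γ n • K i (zz n i - zt n i))‖))
    (hq : ∀ i, Summable (fun n => ‖q (n+1) i - (qt n i - γ n • M i (y n i - yt n i))‖))
    (hz : ∀ i, Summable (fun n => ‖zz (n+1) i - (zt n i + γ n •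
        ContinuousLinearMap.adjoint (K i) (p n i - pt n i))‖))
    (hy : ∀ i, Summable (fun n => ‖y (n+1) i - (yt n i + γ n •
        ContinuousLinearMap.adjoint (M i) (q n i - qt n i))‖))
    (hv : ∀ i, Summable (fun n => ‖v (n+1) i - (vt n i - γ n • L i (x n - xt n))‖))
    :
    Summable (fun n => ‖x n - xt n‖ ^ 2) ∧
    (∀ i, Summable (fun n => ‖p n i - pt n i‖ ^ 2)) ∧
    (∀ i, Summable (fun n => ‖q n i - qt n i‖ ^ 2)) := by
  obtain ⟨xs, us, ws, hus, hws, hzeq⟩ := hran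
  have hdual : ∀ i, ∃ (zs ys : G i) (ps : X i) (qs : Y i),
      ps ∈ esubdiff (g i) (K i zs) ∧ qs ∈ esubdiff (l i) (M i ys) ∧
      ContinuousLinearMap.adjoint (K i) ps = ws i ∧ ContinuousLinearMap.adjoint (M i) qs = ws i ∧
      L i xs - r i = zs + ys := by
    intro i
    obtain ⟨zs, ⟨ps, hps, hK⟩, ys, ⟨qs, hqs, hM⟩, hsum⟩ := hws i
    exact ⟨zs, ys, ps, qs, hps, hqs, hK, hM, hsum⟩
  choose zs ys ps qs hps hqs hKps hMqs hsol using hdual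
  obtain ⟨s, hs, rfl⟩ := hβ
  have hLs : ∑ i, ‖L i‖ ^ 2 ≤ s := hs.2 (Or.inl (Or.inl rfl))
  have hKs : ∀ i, ‖K i‖ ^ 2 ≤ s := fun i => hs.2 (Or.inl (Or.inr ⟨i, rfl⟩))
  have hMs : ∀ i, ‖M i‖ ^ 2 ≤ s := fun i => hs.2 (Or.inr ⟨i, rfl⟩)
  have hβ0 : 0 < μ + √s := by positivity
  have hε1 : ε < 1 := hε.2.trans ((div_lt_one (by positivity)).2 (by linarith))
  have hγ0 : ∀ n, 0 < γ n := fun n => hε.1.trans_le (hγ n).1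
  have hγabs : ∀ n, |γ n| ≤ (1 - ε) / (μ + √s) := fun n =>
    (abs_of_nonneg (hγ0 n).le).trans_le (hγ n).2
  obtain ⟨xh, hxh, hxt'⟩ := hxt
  choose ph hph hpt' using hpt
  choose qh hqh hqt' using hqt
  choose zh yh vh hzt' hyt' hvt' hzh hyh hvh using fun i =>
    exists_exact_dual_step hγabs (hu1 i) (hu2 i) (hzt i) (hyt i) (hvt i)
  let S : PrimalDualSpace H X Y G → PrimalDualSpace H X Y G := forwardOperator L K M h'
  let w : ℕ → PrimalDualSpace H X Y G := fun n => primalDual (x n) (p n) (q n) (zz n) (y n) (v n)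
  let wt : ℕ → PrimalDualSpace H X Y G := fun n =>
    primalDual (xt n) (pt n) (qt n) (zt n) (yt n) (vt n)
  let wh : ℕ → PrimalDualSpace H X Y G := fun n => primalDual (xh n) (fun i => ph i n)
    (fun i => qh i n) (fun i => zh i n) (fun i => yh i n) (fun i => vh i n)
  let wS : PrimalDualSpace H X Y G := primalDual xs ps qs zs ys ws
  have hS : ∀ a b, ‖S a - S b‖ ≤ (μ + √s) * ‖a - b‖ :=
    norm_forwardOperator_sub_le hμ.le hlip hLs hKs hMs
  have hclose : SummablyClose wt wh :=
    SummablyClose.toPrimalDual hxt' hpt' hqt' hzt' hyt' hvt'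
  have hnext : SummablyClose (fun n => w (n + 1)) fun n => wt n + γ n • (S (w n) - S (wt n)) := by
    have hstep : ∀ n, wt n + γ n • (S (w n) - S (wt n)) = primalDual
        (xt n + γ n • (h' (x n) - h' (xt n) +
          ∑ i, ContinuousLinearMap.adjoint (L i) (v n i - vt n i)))
        (fun i => pt n i - γ n • K i (zz n i - zt n i))
        (fun i => qt n i - γ n • M i (y n i - yt n i))
        (fun i => zt n i + γ n • ContinuousLinearMap.adjoint (K i) (p n i - pt n i))
        (fun i => yt n i + γ n • ContinuousLinearMap.adjoint (M i) (q n i - qt n i))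
        (fun i => vt n i - γ n • L i (x n - xt n)) := by
      intro n
      simp only [S, w, wt, forwardOperator_primalDual, primalDual_sub, smul_primalDual,
        primalDual_add]
      congr 1
      · simp only [map_sub, Finset.sum_sub_distrib, add_sub_add_comm]
      all_goals
        funext i
        simp only [Pi.add_apply, Pi.smul_apply, Pi.sub_apply, map_sub]
      all_goals module
    rw [funext hstep]
    exact SummablyClose.toPrimalDual hx hp hq hz hy hv
  have hmono : ∀ n, 0 ≤ ⟪w n - γ n • S (w n) - wh n + γ n • S (wh n), wh n - wS⟫ := by
    intro n
    simp only [S, w, wh, wS, forwardOperator_primalDual, primalDual_sub, smul_primalDual, primalDual_add,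
      inner_primalDual, Pi.add_apply, Pi.smul_apply, Pi.sub_apply]
    rw [Finset.sum_congr rfl fun i _ => inner_dual_block_eq (L i) (K i) (M i) (γ n) (hzh i n)
      (hyh i n) (hvh i n) (hKps i) (hMqs i) (hsol i), Finset.sum_sub_distrib, ← Finset.mul_sum]
    have hp0 : ∀ i, 0 ≤ ⟪p n i + γ n • K i (zz n i) - ph i n - γ n • K i (zs i), ph i n - ps i⟫ :=
      fun i => (hph i n).inner_nonneg (realSegmentConvex_econj _) (econj_ne_bot (hg i)) (hγ0 n)
        (mem_esubdiff_econj (hg i) (hps i))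
    have hq0 : ∀ i, 0 ≤ ⟪q n i + γ n • M i (y n i) - qh i n - γ n • M i (ys i), qh i n - qs i⟫ :=
      fun i => (hqh i n).inner_nonneg (realSegmentConvex_econj _) (econj_ne_bot (hl i)) (hγ0 n)
        (mem_esubdiff_econj (hl i) (hqs i))
    have hx0 := (hxh n).inner_nonneg hf.realSegmentConvex hf.2.1 (hγ0 n) hus
    have hh0 := mul_nonneg (hγ0 n).le (inner_gradient_sub_nonneg hh.convexOn hgrad (xh n) xs)
    have hsum := Finset.sum_nonneg fun i (_ : i ∈ Finset.univ) => add_nonneg (hp0 i) (hq0 i)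
    have hx1 : x n - γ n • (h' (x n) + ∑ i, ContinuousLinearMap.adjoint (L i) (v n i)) - xh n
        + γ n • (h' (xh n) + ∑ i, ContinuousLinearMap.adjoint (L i) (vh i n))
        = (x n - γ n • (h' (x n) + ∑ i, ContinuousLinearMap.adjoint (L i) (v n i) - z) - xh n
            - γ n • us)
          + γ n • (h' (xh n) - h' xs)
          + γ n • ∑ i, ContinuousLinearMap.adjoint (L i) (vh i n - ws i) := by
      simp only [map_sub, Finset.sum_sub_distrib]
      rw [hzeq]
      module
    rw [hx1, inner_add_left, inner_add_left, real_inner_smul_left, real_inner_smul_left,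
      sum_inner]
    simp only [ContinuousLinearMap.adjoint_inner_left]
    linarith
  have hres := summable_forward_backward_forward_residual hβ0 hS hε.1 hε1
    (fun n => (hγ0 n).le) (fun n => (hγ n).2) hclose hnext hmono
  have hsub : ∀ n, w n - wt n = primalDual (x n - xt n) (p n - pt n) (q n - qt n) (zz n - zt n)
      (y n - yt n) (v n - vt n) := fun _ => rfl
  have hx_le : ∀ n, ‖x n - xt n‖ ^ 2 ≤ ‖w n - wt n‖ ^ 2 := fun n => by
    rw [hsub n]
    exact norm_sq_le_norm_primalDual_sq ..
  have hpq_le : ∀ i n, ‖p n i - pt n i‖ ^ 2 + ‖q n i - qt n i‖ ^ 2 ≤ ‖w n - wt n‖ ^ 2 :=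
    fun i n => by
      rw [hsub n]
      exact norm_sq_add_norm_sq_le_norm_primalDual_sq (x n - xt n) (p n - pt n) (q n - qt n)
        (zz n - zt n) (y n - yt n) (v n - vt n) i
  exact ⟨Summable.of_nonneg_of_le (fun _ => sq_nonneg _) hx_le hres,
    fun i => Summable.of_nonneg_of_le (fun _ => sq_nonneg _)
      (fun n => (le_add_of_nonneg_right (sq_nonneg _)).trans (hpq_le i n)) hres,
    fun i => Summable.of_nonneg_of_le (fun _ => sq_nonneg _)
      (fun n => (le_add_of_nonneg_left (sq_nonneg _)).trans (hpq_le i n)) hres⟩
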